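/- Let 𝔽 be a perfect field with algebraic closure 𝔽̄, let V ⊆ 𝔽̄^n be an irreducible variety defined over 𝔽, let x₀ be a non-singular point of V, and let f : 𝔽^n → 𝔽^{m × n'} be a polynomial matrix (a polynomial map into the space of 2-tensors A ⊗ B with A = 𝔽^m, B = 𝔽^{n'}). Suppose there exists a rational map H : 𝔽^n ⇢ C_r(A ⊗ B), defined at x₀, such that f(x) = IP(H(x)) for every x ∈ V at which H is defined. Then for every a ∈ ℕ there exists a rational map H' : 𝔽^n ⇢ C_s(A ⊗ B ⊗ (𝔽^n)^{⊗a}), defined at x₀, such that D^a f(x) = IP(H'(x)) for every x ∈ V at which H' is defined, where s = max{r, codim V} and D^a f is the order-a formal total derivative of f, the (a+2)-tensor-valued polynomial map whose entries are the a-fold partial derivatives ∂_{j_1}⋯∂_{j_a} f_{i,j}. -/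

import Mathlib

/-- `V` is a Zariski-closed set. -/
def IsZeroLocus (K : Type*) [CommRing K] {ι : Type*} (V : Set (ι → K)) : Prop :=
  ∃ s : Set (MvPolynomial ι K), V = {x | ∀ p ∈ s, MvPolynomial.eval x p = 0}

/-- `V ⊆ K^ι` is cut out by polynomials with coefficients in `F`. -/
def IsZeroLocusOver (F K : Type*) [CommRing F] [CommRing K] [Algebra F K]
    {ι : Type*} (V : Set (ι → K)) : Prop :=
  ∃ s : Set (MvPolynomial ι F), V = {x | ∀ p ∈ s, MvPolynomial.aeval x p = 0}

/-- `V` is an irreducible variety. -/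
def IsIrredVariety (K : Type*) [CommRing K] {ι : Type*} (V : Set (ι → K)) : Prop :=
  IsZeroLocus K V ∧ V.Nonempty ∧
    ∀ V₁ V₂ : Set (ι → K), IsZeroLocus K V₁ → IsZeroLocus K V₂ →
      V = V₁ ∪ V₂ → V = V₁ ∨ V = V₂

/-- The vanishing ideal of a set `V ⊆ K^ι`. -/
def vanishingIdeal (K : Type*) [CommRing K] {ι : Type*} (V : Set (ι → K)) :
    Ideal (MvPolynomial ι K) where
  carrier := {p | ∀ x ∈ V, MvPolynomial.eval x p = 0}
  add_mem' := by
    intro a b ha hb x hx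
    simp [ha x hx, hb x hx]
  zero_mem' := by
    intro x hx
    simp
  smul_mem' := by
    intro c p hp x hx
    simp [smul_eq_mul, hp x hx]

/-- The dimension of a variety: the Krull dimension of its coordinate ring. -/
noncomputable def varDim (K : Type*) [CommRing K] {ι : Type*} (V : Set (ι → K)) :
    WithBot (WithTop ℕ) :=
  ringKrullDim (MvPolynomial ι K ⧸ vanishingIdeal K V)

/-- The tangent space of `V` at `x`. -/
def tangentSpace (K : Type*) [Field K] {ι : Type*} [Fintype ι]
    (V : Set (ι → K)) (x : ι → K) : Submodule K (ι → K) where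
  carrier := {v | ∀ p ∈ vanishingIdeal K V,
    ∑ j, MvPolynomial.eval x (MvPolynomial.pderiv j p) * v j = 0}
  add_mem' := by
    intro v w hv hw p hp
    have h1 := hv p hp
    have h2 := hw p hp
    have key : ∑ j, MvPolynomial.eval x (MvPolynomial.pderiv j p) * (v + w) j
        = (∑ j, MvPolynomial.eval x (MvPolynomial.pderiv j p) * v j)
          + ∑ j, MvPolynomial.eval x (MvPolynomial.pderiv j p) * w j := by
      rw [← Finset.sum_add_distrib]
      exact Finset.sum_congr rfl fun j _ => by simp [mul_add]
    simp only [key, h1, h2, add_zero]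
  zero_mem' := by
    intro p hp
    simp
  smul_mem' := by
    intro c v hv p hp
    have h := hv p hp
    have key : ∑ j, MvPolynomial.eval x (MvPolynomial.pderiv j p) * (c • v) j
        = c * ∑ j, MvPolynomial.eval x (MvPolynomial.pderiv j p) * v j := by
      rw [Finset.mul_sum]
      exact Finset.sum_congr rfl fun j _ => by
        simp only [Pi.smul_apply, smul_eq_mul]; ring
    simp only [key, h, mul_zero]

/-- `x` is a non-singular point of the irreducible variety `V`. -/
def IsNonsingularPoint (K : Type*) [Field K] {ι : Type*} [Fintype ι]
    (V : Set (ι → K)) (x : ι → K) : Prop :=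
  x ∈ V ∧ ((Module.finrank K ↥(tangentSpace K V x) : ℕ) : WithBot (WithTop ℕ)) = varDim K V

/-- Iterated formal partial derivative `∂_{t 0} ⋯ ∂_{t (a-1)}`. -/
noncomputable def iterPDeriv {σ : Type*} {F : Type*} [CommSemiring F] :
    (a : ℕ) → (Fin a → σ) → MvPolynomial σ F → MvPolynomial σ F
  | 0, _, p => p
  | a+1, t, p => iterPDeriv a (fun s => t s.castSucc) (MvPolynomial.pderiv (t (Fin.last a)) p)


section AuxHelpers
open MvPolynomial

theorem aux_ringKrullDim_le_of_trdeg {K A L : Type} [Field K] [CommRing A] [IsDomain A] [Algebra K A]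
    [Algebra.FiniteType K A] [Field L] [Algebra A L] [IsFractionRing A L] [Algebra K L]
    [IsScalarTower K A L] (e : ℕ) (h : Algebra.trdeg K L ≤ e) : ringKrullDim A ≤ e := by
  obtain ⟨s, g, hinj, hint⟩ := exists_integral_inj_algHom_of_fg K A
  have h1 : ringKrullDim A ≤ s := by
    have h2 : ringKrullDim (MvPolynomial (Fin s) K) = s := by
      rw [MvPolynomial.ringKrullDim_of_isNoetherianRing]; simp
    rw [← h2]
    let : Algebra (MvPolynomial (Fin s) K) A := g.toRingHom.toAlgebra
    have : Algebra.IsIntegral (MvPolynomial (Fin s) K) A := ⟨hint⟩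
    refine Order.krullDim_le_of_strictMono
      (PrimeSpectrum.comap (algebraMap (MvPolynomial (Fin s) K) A)) ?_
    intro p q hpq
    exact Ideal.IsIntegral.comap_lt_comap (R := MvPolynomial (Fin s) K) (I := p.asIdeal) (J := q.asIdeal) hpq
  refine h1.trans ?_
  have hai : AlgebraicIndependent K (fun i : Fin s => algebraMap A L (g (X i))) := by
    have : AlgebraicIndependent K (fun i : Fin s => (X i : MvPolynomial (Fin s) K)) :=
      MvPolynomial.algebraicIndependent_X _ _
    have := this.map' (f := (IsScalarTower.toAlgHom K A L).comp g)
      (by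
        rw [AlgHom.coe_comp]
        exact (FaithfulSMul.algebraMap_injective A L).comp hinj)
    exact this
  have := hai.cardinalMk_le_trdeg.trans h
  simp at this
  exact_mod_cast this

theorem aux_chain {K L M E : Type} [Field K] [Field L] [Field E] [Algebra K L] [Algebra E L]
   [AddCommGroup M] [Module L M] [Module E M] (D : Derivation E L M)
   (hD : ∀ k : K, D (algebraMap K L k) = 0) {n : ℕ} (ξ : Fin n → L) (p : MvPolynomial (Fin n) K) :
   D (aeval ξ p) = ∑ j, aeval ξ (pderiv j p) • D (ξ j) := by
  induction p using MvPolynomial.induction_on with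
  | C a => simp [hD]
  | add p q hp hq => simp [hp, hq, add_smul, Finset.sum_add_distrib]
  | mul_X p i hp =>
    simp only [map_mul, aeval_X, Derivation.leibniz, hp, pderiv_X, smul_eq_mul, map_add, add_smul,
      Finset.sum_add_distrib, Finset.smul_sum, smul_smul]
    congr 1
    rw [Finset.sum_eq_single i]
    · simp
    · intro b _ hb
      simp [hb]
    · simp

theorem aux_dim_le {K L : Type} [Field K] {n : ℕ} (I : Ideal (MvPolynomial (Fin n) K)) [I.IsPrime]
    [Field L] [Algebra (MvPolynomial (Fin n) K ⧸ I) L] [IsFractionRing (MvPolynomial (Fin n) K ⧸ I) L]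
    [Algebra K L] [IsScalarTower K (MvPolynomial (Fin n) K ⧸ I) L]
    (ξ : Fin n → L) (hξ : ∀ j, ξ j = algebraMap (MvPolynomial (Fin n) K ⧸ I) L (Ideal.Quotient.mk I (X j)))
    (s : Finset (Fin n))
    (H : ∀ (M : Type) [AddCommGroup M] [Module L M] (w : Fin n → M), (∀ j, j ∉ s → w j = 0) →
      (∀ p ∈ I, ∑ j, aeval ξ (pderiv j p) • w j = 0) → ∀ j, w j = 0) :
    ringKrullDim (MvPolynomial (Fin n) K ⧸ I) ≤ (n - s.card : ℕ) := by
  have hae : ∀ p, aeval ξ p = algebraMap (MvPolynomial (Fin n) K ⧸ I) L (Ideal.Quotient.mk I p) := by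
    intro p
    have : (aeval ξ : MvPolynomial (Fin n) K →ₐ[K] L) =
      (IsScalarTower.toAlgHom K (MvPolynomial (Fin n) K ⧸ I) L).comp (Ideal.Quotient.mkₐ K I) := by
      ext j
      simp [hξ]
    rw [this]; rfl
  let S : Set L := ξ '' (↑sᶜ : Set (Fin n))
  let E := IntermediateField.adjoin K S
  have : Algebra.EssFiniteType K L := by
    have := Algebra.EssFiniteType.of_isLocalization (R := MvPolynomial (Fin n) K ⧸ I) L (nonZeroDivisors _)
    exact Algebra.EssFiniteType.comp K (MvPolynomial (Fin n) K ⧸ I) L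
  have : Algebra.EssFiniteType E L := Algebra.EssFiniteType.of_comp K E L
  have hx : ∀ j, KaehlerDifferential.D E L (ξ j) = 0 := by
    apply H
    · intro j hj
      have : ξ j ∈ E := IntermediateField.subset_adjoin _ _ ⟨j, by simpa using hj, rfl⟩
      exact (KaehlerDifferential.D E L).map_algebraMap ⟨ξ j, this⟩
    · intro p hp
      rw [← aux_chain (KaehlerDifferential.D E L) _ ξ p, hae, Ideal.Quotient.eq_zero_iff_mem.mpr hp]
      · simp
      · intro k
        exact (KaehlerDifferential.D E L).map_algebraMap (algebraMap K E k)
  have hpoly : ∀ p : MvPolynomial (Fin n) K, KaehlerDifferential.D E L (aeval ξ p) = 0 := by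
    intro p
    rw [aux_chain (KaehlerDifferential.D E L) _ ξ p]
    · simp [hx]
    · intro k
      exact (KaehlerDifferential.D E L).map_algebraMap (algebraMap K E k)
  have hall : ∀ y, KaehlerDifferential.D E L y = 0 := by
    intro y
    obtain ⟨a, b, hb, rfl⟩ := IsFractionRing.div_surjective (A := MvPolynomial (Fin n) K ⧸ I) y
    obtain ⟨a, rfl⟩ := Ideal.Quotient.mk_surjective a
    obtain ⟨b, rfl⟩ := Ideal.Quotient.mk_surjective b
    have hb0 : aeval ξ b ≠ 0 := by
      rw [hae]
      exact IsFractionRing.to_map_ne_zero_of_mem_nonZeroDivisors hb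
    rw [← hae, ← hae]
    have h1 : aeval ξ b * (aeval ξ a / aeval ξ b) = aeval ξ a := by field_simp
    have h2 := congrArg (KaehlerDifferential.D E L) h1
    rw [Derivation.leibniz, hpoly, hpoly, smul_zero, add_zero] at h2
    exact (smul_eq_zero.mp h2).resolve_left hb0
  have : Algebra.FormallyUnramified E L := by
    refine ⟨?_⟩
    refine subsingleton_of_forall_eq 0 fun x => ?_
    have : x ∈ Submodule.span L (Set.range (KaehlerDifferential.D E L)) := by
      rw [KaehlerDifferential.span_range_derivation]; trivial
    have h0 : Set.range (KaehlerDifferential.D E L) ⊆ {0} := by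
      rintro _ ⟨y, rfl⟩; simp [hall y]
    have := Submodule.span_mono h0 this
    simpa using this
  have := Algebra.FormallyUnramified.isSeparable E L
  have halg : Algebra.IsAlgebraic (Algebra.adjoin K S) L :=
    IntermediateField.isAlgebraic_adjoin_iff_top.mp (inferInstanceAs (Algebra.IsAlgebraic E L))
  have htr := Algebra.IsAlgebraic.trdeg_le_cardinalMk K S
  apply aux_ringKrullDim_le_of_trdeg (K := K) (L := L)
  refine htr.trans ?_
  have : Cardinal.mk S ≤ Cardinal.mk (↑sᶜ : Set (Fin n)) := Cardinal.mk_image_le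
  refine this.trans ?_
  exact (Cardinal.mk_coe_finset (s := sᶜ)).le.trans (by simp [Finset.card_compl])

theorem aux_jac {K : Type} [Field K] {n : ℕ} (I : Ideal (MvPolynomial (Fin n) K)) [I.IsPrime]
    (c : ℕ) (hc : ringKrullDim (MvPolynomial (Fin n) K ⧸ I) + c = n)
    (g : Fin c → MvPolynomial (Fin n) K) (hg : ∀ k, g k ∈ I) (e : Fin c → Fin n)
    (he : Function.Injective e)
    (M : Matrix (Fin c) (Fin c) (MvPolynomial (Fin n) K)) (hM : ∀ k j, M k j = pderiv (e j) (g k))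
    (hdet : M.det ∉ I) (h : MvPolynomial (Fin n) K) (hh : h ∈ I) (l : Fin n) :
    M.det * pderiv l h - ∑ k, (∑ j, pderiv (e j) h * M.adjugate j k) * pderiv l (g k) ∈ I := by
  have hμ : ∀ i, ∑ k, (∑ j, pderiv (e j) h * M.adjugate j k) * M k i = M.det * pderiv (e i) h := by
    intro i
    have h1 : ∀ j, ∑ k, M.adjugate j k * M k i = if j = i then M.det else 0 := by
      intro j
      have := congrFun (congrFun (Matrix.adjugate_mul M) j) i
      simpa [Matrix.mul_apply, Matrix.one_apply] using this
    simp_rw [Finset.sum_mul]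
    rw [Finset.sum_comm]
    simp_rw [mul_assoc, ← Finset.mul_sum, h1]
    simp [mul_comm]
  by_cases hl : ∃ i, e i = l
  · obtain ⟨i, rfl⟩ := hl
    simp_rw [← hM, hμ]
    simp
  push Not at hl
  by_contra hE
  let L := FractionRing (MvPolynomial (Fin n) K ⧸ I)
  let ξ : Fin n → L := fun j => algebraMap (MvPolynomial (Fin n) K ⧸ I) L (Ideal.Quotient.mk I (X j))
  have hae : ∀ p, aeval ξ p = algebraMap (MvPolynomial (Fin n) K ⧸ I) L (Ideal.Quotient.mk I p) := by
    intro p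
    have : (aeval ξ : MvPolynomial (Fin n) K →ₐ[K] L) =
      (IsScalarTower.toAlgHom K (MvPolynomial (Fin n) K ⧸ I) L).comp (Ideal.Quotient.mkₐ K I) := by
      ext j
      simp [ξ]
    rw [this]; rfl
  have hne : ∀ p, p ∉ I → aeval ξ p ≠ 0 := by
    intro p hp h0
    rw [hae] at h0
    have := (FaithfulSMul.algebraMap_injective (MvPolynomial (Fin n) K ⧸ I) L) (h0.trans (map_zero _).symm)
    exact hp (Ideal.Quotient.eq_zero_iff_mem.mp this)
  classical
  let s : Finset (Fin n) := insert l (Finset.univ.image e)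
  have hlnot : l ∉ Finset.univ.image e := by simpa using hl
  have hcard : s.card = c + 1 := by
    rw [Finset.card_insert_of_notMem hlnot, Finset.card_image_of_injective _ he]; simp
  have key := aux_dim_le (L := L) I ξ (fun _ => rfl) s (by
    intro N _ _ w hw hp
    have hp' : ∀ p ∈ I, aeval ξ (pderiv l p) • w l + ∑ i, aeval ξ (pderiv (e i) p) • w (e i) = 0 := by
      intro p hpI
      rw [← hp p hpI, ← Finset.sum_subset (Finset.subset_univ s), Finset.sum_insert hlnot,
        Finset.sum_image (fun _ _ _ _ h => he h)]
      intro x _ hx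
      rw [hw x hx, smul_zero]
    have hEw : aeval ξ (M.det * pderiv l h -
        ∑ k, (∑ j, pderiv (e j) h * M.adjugate j k) * pderiv l (g k)) • w l = 0 := by
      have h1 : M.det • (1 : MvPolynomial (Fin n) K) = M.det := by simp
      have h2 : ∑ k, aeval ξ (∑ j, pderiv (e j) h * M.adjugate j k) •
          (aeval ξ (pderiv l (g k)) • w l + ∑ i, aeval ξ (pderiv (e i) (g k)) • w (e i)) = 0 :=
        Finset.sum_eq_zero fun k _ => by rw [hp' _ (hg k), smul_zero]
      have h3 : aeval ξ M.det • (aeval ξ (pderiv l h) • w l + ∑ i, aeval ξ (pderiv (e i) h) • w (e i)) = 0 := by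
        rw [hp' _ hh, smul_zero]
      have h4 : ∑ k, aeval ξ (∑ j, pderiv (e j) h * M.adjugate j k) •
          ∑ i, aeval ξ (pderiv (e i) (g k)) • w (e i)
          = aeval ξ M.det • ∑ i, aeval ξ (pderiv (e i) h) • w (e i) := by
        simp_rw [Finset.smul_sum, smul_smul, ← map_mul, ← hM]
        rw [Finset.sum_comm]
        simp_rw [← Finset.sum_smul, ← map_sum, hμ]
      simp_rw [smul_add, Finset.sum_add_distrib, h4] at h2
      rw [smul_add] at h3
      have h5 := h3.trans h2.symm
      rw [add_left_inj] at h5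
      rw [map_sub, sub_smul, map_mul, mul_smul, h5, map_sum, Finset.sum_smul, sub_eq_zero]
      refine Finset.sum_congr rfl fun k _ => ?_
      rw [map_mul, mul_smul]
    have hwl : w l = 0 := (smul_eq_zero.mp hEw).resolve_left (hne _ hE)
    have hwe : ∀ i, w (e i) = 0 := by
      intro i
      have h2 : ∑ k, aeval ξ (M.adjugate i k) •
          (aeval ξ (pderiv l (g k)) • w l + ∑ i, aeval ξ (pderiv (e i) (g k)) • w (e i)) = 0 :=
        Finset.sum_eq_zero fun k _ => by rw [hp' _ (hg k), smul_zero]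
      have h1 : ∀ j, ∑ k, M.adjugate i k * M k j = if i = j then M.det else 0 := by
        intro j
        have := congrFun (congrFun (Matrix.adjugate_mul M) i) j
        simpa [Matrix.mul_apply, Matrix.one_apply] using this
      simp_rw [hwl, smul_zero, zero_add, Finset.smul_sum, smul_smul, ← map_mul, ← hM] at h2
      rw [Finset.sum_comm] at h2
      simp_rw [← Finset.sum_smul, ← map_sum, h1] at h2
      rw [Finset.sum_eq_single i] at h2
      · simp only [if_true] at h2
        exact (smul_eq_zero.mp h2).resolve_left (hne _ hdet)
      · intro b _ hb
        simp [hb.symm]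
      · simp
    intro j
    by_cases hj : j ∈ s
    · rcases Finset.mem_insert.mp hj with rfl | hj
      · exact hwl
      · obtain ⟨i, -, rfl⟩ := Finset.mem_image.mp hj
        exact hwe i
    · exact hw j hj)
  have hle : s.card ≤ n := by simpa using Finset.card_le_univ s
  have h6 : (n : WithBot ℕ∞) ≤ ((n - s.card : ℕ) : WithBot ℕ∞) + (c : WithBot ℕ∞) := by
    rw [← hc]; gcongr
  have h7 : n ≤ (n - s.card) + c := by exact_mod_cast h6
  omega

theorem aux_minor {K ι : Type} [Field K] {n : ℕ} (ρ : ι → Fin n → K) (T : Submodule K (Fin n → K))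
    (hT : ∀ v, v ∈ T ↔ ∀ i, ∑ j, ρ i j * v j = 0) (c : ℕ) (hc : Module.finrank K T + c = n) :
    ∃ (a : Fin c → ι) (e : Fin c → Fin n), Function.Injective e ∧
      (Matrix.of fun k j => ρ (a k) (e j)).det ≠ 0 := by
  classical
  obtain ⟨κ, a, -, hspan, hli⟩ := exists_linearIndependent' K ρ
  have : Finite κ := hli.finite
  have : Fintype κ := Fintype.ofFinite κ
  let A : Matrix κ (Fin n) K := Matrix.of fun k j => ρ (a k) j
  have hAr : A.rank = Fintype.card κ := LinearIndependent.rank_matrix (M := A) hli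
  have hker : A.mulVecLin.ker = T := by
    ext v
    rw [hT, LinearMap.mem_ker]
    constructor
    · intro h i
      let φ : (Fin n → K) →ₗ[K] K := Fintype.linearCombination K v
      have hφ : ∀ w : Fin n → K, φ w = ∑ j, w j * v j := by
        intro w; simp [φ, Fintype.linearCombination_apply]
      have h1 : Submodule.span K (Set.range ρ) ≤ φ.ker := by
        rw [← hspan, Submodule.span_le]
        rintro _ ⟨k, rfl⟩
        have := congrFun h k
        simp only [SetLike.mem_coe, LinearMap.mem_ker, hφ]
        simpa [A, Matrix.mulVec, dotProduct] using this
      have h2 := h1 (Submodule.subset_span ⟨i, rfl⟩)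
      rwa [LinearMap.mem_ker, hφ] at h2
    · intro h
      ext k
      simpa [A, Matrix.mulVec, dotProduct] using h (a k)
  have hrn := LinearMap.finrank_range_add_finrank_ker A.mulVecLin
  rw [hker] at hrn
  have hrank : Module.finrank K A.mulVecLin.range = A.rank := rfl
  rw [hrank, hAr, Module.finrank_fin_fun] at hrn
  have hcard : Fintype.card κ = c := by omega
  obtain ⟨κ', e, he, hspan', hli'⟩ := exists_linearIndependent' K A.col
  have : Finite κ' := hli'.finite
  have : Fintype κ' := Fintype.ofFinite κ'
  have hcard' : Fintype.card κ' = c := by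
    rw [← finrank_span_eq_card hli', hspan', ← Matrix.rank_eq_finrank_span_cols, hAr, hcard]
  let q : Fin c ≃ κ := (Fintype.equivFinOfCardEq hcard).symm
  let q' : Fin c ≃ κ' := (Fintype.equivFinOfCardEq hcard').symm
  refine ⟨a ∘ q, e ∘ q', he.comp q'.injective, ?_⟩
  rw [← isUnit_iff_ne_zero, ← Matrix.isUnit_iff_isUnit_det, ← Matrix.linearIndependent_cols_iff_isUnit]
  have h1 := hli'.comp q' q'.injective
  have h2 := h1.map' (LinearMap.funLeft K K q) (LinearMap.ker_eq_bot.mpr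
    (LinearMap.funLeft_injective_of_surjective K K q q.surjective))
  exact h2

theorem aux_descent (F : Type) [Field F] [PerfectField F] {n : ℕ}
    (V : Set (Fin n → AlgebraicClosure F)) (hVF : IsZeroLocusOver F (AlgebraicClosure F) V)
    (x₀ v : Fin n → AlgebraicClosure F)
    (hv : ∀ p : MvPolynomial (Fin n) F, (∀ x ∈ V, aeval x p = 0) →
      ∑ j, aeval x₀ (pderiv j p) * v j = 0) :
    v ∈ tangentSpace (AlgebraicClosure F) V x₀ := by
  classical
  obtain ⟨Z, hZ⟩ := hVF
  intro p hp
  let S : Set (AlgebraicClosure F) := ↑p.coeffs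
  let L := IntermediateField.adjoin F S
  have hfin : Finite S := p.coeffs.finite_toSet
  have : FiniteDimensional F L := IntermediateField.finiteDimensional_adjoin
    fun x _ => Algebra.IsIntegral.isIntegral x
  have : Algebra.IsSeparable F L := inferInstance
  obtain ⟨P, hP⟩ : p ∈ Set.range (map (algebraMap L (AlgebraicClosure F))) := by
    rw [mem_range_map_iff_coeffs_subset]
    intro x hx
    exact ⟨⟨x, IntermediateField.subset_adjoin F S hx⟩, rfl⟩
  -- conjugates vanish on V
  have hconj : ∀ (τ : L →ₐ[F] AlgebraicClosure F), ∀ x ∈ V, eval x (map (τ : L →+* _) P) = 0 := by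
    intro τ x hx
    obtain ⟨φ, hφ⟩ := IsAlgClosed.surjective_domRestrict_of_isAlgebraic (K := F)
      (E := AlgebraicClosure F) τ
    have hb := Algebra.IsAlgebraic.algHom_bijective φ
    choose y hy using fun j => hb.2 (x j)
    have hyV : y ∈ V := by
      rw [hZ] at hx ⊢
      intro r hr
      apply hb.1
      have h1 := hx r hr
      have hxy : x = fun j => φ (y j) := funext fun j => (hy j).symm
      rw [hxy] at h1
      rw [map_zero, ← h1]
      exact (MvPolynomial.map_aeval y φ.toRingHom r).trans (by
        simp [aeval_def])
    have h2 := hp y hyV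
    rw [← hP] at h2
    have h3 := congrArg φ h2
    rw [map_zero] at h3
    rw [← h3]
    have hτ : (τ : L →+* AlgebraicClosure F) = (φ : AlgebraicClosure F →+* AlgebraicClosure F).comp
        (algebraMap L (AlgebraicClosure F)) := by
      ext z
      have := congrArg (fun f : L →ₐ[F] AlgebraicClosure F => f z) hφ
      exact this.symm
    have hxy : x = fun j => φ (y j) := funext fun j => (hy j).symm
    rw [hτ, hxy, ← MvPolynomial.map_map]
    exact (MvPolynomial.eval₂_comp_left (φ : AlgebraicClosure F →+* AlgebraicClosure F)
      (RingHom.id _) y _ |>.trans (by simp [eval_map, Function.comp_def])).symm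
  let t : L → MvPolynomial (Fin n) F := fun b =>
    ∑ m ∈ P.support, monomial m (Algebra.trace F L (b * coeff m P))
  have ht : ∀ b, map (algebraMap F (AlgebraicClosure F)) (t b) =
      ∑ τ : L →ₐ[F] AlgebraicClosure F, C (τ b) * map (τ : L →+* _) P := by
    intro b
    ext m
    simp only [t, map_sum, map_monomial, coeff_sum, coeff_monomial, coeff_C_mul, coeff_map]
    rw [Finset.sum_ite_eq']
    split_ifs with hm
    · rw [trace_eq_sum_embeddings (AlgebraicClosure F)]
      exact Finset.sum_congr rfl fun τ _ => map_mul τ _ _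
    · have : coeff m P = 0 := by simpa using hm
      simp [this]
  have hae : ∀ (x : Fin n → AlgebraicClosure F) (r : MvPolynomial (Fin n) F),
      aeval x r = eval x (map (algebraMap F (AlgebraicClosure F)) r) := by
    intro x r
    rw [eval_map]; rfl
  have hzero : ∀ b, ∑ τ : L →ₐ[F] AlgebraicClosure F,
      (∑ j, eval x₀ (pderiv j (map (τ : L →+* _) P)) * v j) * τ b = 0 := by
    intro b
    have h1 := hv (t b) (by
      intro x hx
      rw [hae, ht, map_sum]
      refine Finset.sum_eq_zero fun τ _ => ?_
      rw [map_mul, hconj τ x hx, mul_zero])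
    rw [← h1]
    simp_rw [hae, ← pderiv_map, ht, map_sum, pderiv_C_mul, map_mul, eval_C, Finset.sum_mul]
    rw [Finset.sum_comm]
    refine Finset.sum_congr rfl fun _ _ => Finset.sum_congr rfl fun _ _ => ?_
    ring
  have hli := linearIndependent_algHom_toLinearMap F L (AlgebraicClosure F)
  rw [Fintype.linearIndependent_iff] at hli
  have := hli (fun τ => ∑ j, eval x₀ (pderiv j (map (τ : L →+* _) P)) * v j) (by
    ext b
    simpa using hzero b) L.val
  rw [← hP]
  exact this

theorem aux_prime {K : Type} [Field K] {n : ℕ} (V : Set (Fin n → K)) (hV : IsIrredVariety K V) :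
    (_root_.vanishingIdeal K V).IsPrime := by
  obtain ⟨⟨s, hs⟩, ⟨y, hy⟩, hirr⟩ := hV
  refine ⟨?_, ?_⟩
  · intro h
    have h1 : (1 : MvPolynomial (Fin n) K) ∈ _root_.vanishingIdeal K V := by rw [h]; trivial
    simpa using h1 y hy
  · intro p q hpq
    have hcl : ∀ r : MvPolynomial (Fin n) K, IsZeroLocus K {x | x ∈ V ∧ eval x r = 0} := by
      intro r
      refine ⟨insert r s, ?_⟩
      ext x
      simp only [hs, Set.mem_ofPred_eq, Set.forall_mem_insert]
      tauto
    have h := hirr _ _ (hcl p) (hcl q) (by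
      ext x
      constructor
      · intro hx
        have := hpq x hx
        rw [map_mul, mul_eq_zero] at this
        rcases this with h | h
        · exact Or.inl ⟨hx, h⟩
        · exact Or.inr ⟨hx, h⟩
      · rintro (h | h) <;> exact h.1)
    rcases h with h | h
    · left
      intro x hx
      rw [h] at hx
      exact hx.2
    · right
      intro x hx
      rw [h] at hx
      exact hx.2

theorem aux_key (F : Type) [Field F] [PerfectField F] {n : ℕ}
    (V : Set (Fin n → AlgebraicClosure F)) (hVirr : IsIrredVariety (AlgebraicClosure F) V)
    (hVF : IsZeroLocusOver F (AlgebraicClosure F) V)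
    (x₀ : Fin n → AlgebraicClosure F) (hx₀ : IsNonsingularPoint (AlgebraicClosure F) V x₀)
    (c : ℕ) (hc : varDim (AlgebraicClosure F) V + (c : WithBot (WithTop ℕ))
      = (n : WithBot (WithTop ℕ))) :
    ∃ (Δ : MvPolynomial (Fin n) F) (g : Fin c → MvPolynomial (Fin n) F)
      (μ : Fin c → MvPolynomial (Fin n) F → MvPolynomial (Fin n) F),
      aeval x₀ Δ ≠ 0 ∧ ∀ h : MvPolynomial (Fin n) F, (∀ x ∈ V, aeval x h = 0) →
        ∀ l, ∀ x ∈ V, aeval x (Δ * pderiv l h - ∑ k, μ k h * pderiv l (g k)) = 0 := by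
  have hae : ∀ (x : Fin n → AlgebraicClosure F) (r : MvPolynomial (Fin n) F),
      aeval x r = eval x (map (algebraMap F (AlgebraicClosure F)) r) := by
    intro x r
    rw [eval_map]; rfl
  have hprime := aux_prime V hVirr
  have hfr : Module.finrank (AlgebraicClosure F) (tangentSpace (AlgebraicClosure F) V x₀) + c = n := by
    have h1 := hc
    rw [← hx₀.2] at h1
    exact_mod_cast h1
  obtain ⟨a, e, he, hdet⟩ := aux_minor
    (fun (p : {p : MvPolynomial (Fin n) F // ∀ x ∈ V, aeval x p = 0}) j => aeval x₀ (pderiv j p.1))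
    (tangentSpace (AlgebraicClosure F) V x₀) (by
      intro v
      constructor
      · intro hv p
        have := hv (map (algebraMap F (AlgebraicClosure F)) p.1) (by
          intro x hx
          rw [← hae]; exact p.2 x hx)
        simpa only [hae, pderiv_map] using this
      · intro h
        exact aux_descent F V hVF x₀ v fun p hp => h ⟨p, hp⟩) c hfr
  let M : Matrix (Fin c) (Fin c) (MvPolynomial (Fin n) F) :=
    Matrix.of fun k j => pderiv (e j) (a k).1
  let ι : MvPolynomial (Fin n) F →+* MvPolynomial (Fin n) (AlgebraicClosure F) :=
    map (algebraMap F (AlgebraicClosure F))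
  have hΔ : aeval x₀ M.det ≠ 0 := by
    have : aeval x₀ M.det = (Matrix.of fun k j => aeval x₀ (pderiv (e j) (a k).1)).det := by
      rw [AlgHom.map_det]; rfl
    rw [this]; exact hdet
  refine ⟨M.det, fun k => (a k).1, fun k h => ∑ j, pderiv (e j) h * M.adjugate j k, hΔ, ?_⟩
  intro h hh l x hx
  have hdet' : (ι.mapMatrix M).det = ι M.det := (RingHom.map_det ι M).symm
  have hadj : ∀ j k, (ι.mapMatrix M).adjugate j k = ι (M.adjugate j k) := by
    intro j k
    rw [← RingHom.map_adjugate]; rfl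
  have hmem := aux_jac (_root_.vanishingIdeal (AlgebraicClosure F) V) c hc (fun k => ι (a k).1)
    (fun k x hx => by
      have := (a k).2 x hx
      rwa [hae] at this) e he (ι.mapMatrix M)
    (fun k j => by
      simp only [RingHom.mapMatrix_apply, Matrix.map_apply, M, Matrix.of_apply, ι, pderiv_map])
    (by
      rw [hdet']
      intro h0
      apply hΔ
      rw [hae]
      exact h0 x₀ hx₀.1)
    (ι h) (fun x hx => by
      have := hh x hx
      rwa [hae] at this) l
  have h2 := hmem x hx
  rw [hdet'] at h2
  simp only [hadj, ι, pderiv_map] at h2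
  refine (hae x _).trans (Eq.trans ?_ h2)
  simp only [map_sub, map_mul, map_sum]

theorem aux_pderiv_comm {F : Type} [Field F] {n : ℕ} (i j : Fin n) (p : MvPolynomial (Fin n) F) :
    pderiv i (pderiv j p) = pderiv j (pderiv i p) := by
  have : ⁅(pderiv i : Derivation F (MvPolynomial (Fin n) F) (MvPolynomial (Fin n) F)),
      (pderiv j : Derivation F (MvPolynomial (Fin n) F) (MvPolynomial (Fin n) F))⁆ = 0 := by
    apply MvPolynomial.derivation_ext
    intro k
    rw [Derivation.commutator_apply]
    simp [pderiv_X, Pi.single_apply, apply_ite]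
  have h := congrArg (fun D : Derivation F (MvPolynomial (Fin n) F) (MvPolynomial (Fin n) F) => D p) this
  simp only [Derivation.commutator_apply, Derivation.zero_apply] at h
  exact sub_eq_zero.mp h

theorem aux_iter_zero {F : Type} [Field F] {n : ℕ} (t : Fin 0 → Fin n)
    (p : MvPolynomial (Fin n) F) : iterPDeriv 0 t p = p := by
  rw [iterPDeriv]

theorem aux_iter_succ {F : Type} [Field F] {n : ℕ} (a : ℕ) (t : Fin (a + 1) → Fin n)
    (p : MvPolynomial (Fin n) F) : iterPDeriv (a + 1) t p =
      iterPDeriv a (fun s => t s.castSucc) (pderiv (t (Fin.last a)) p) := by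
  rw [iterPDeriv]

theorem aux_iter_comm {F : Type} [Field F] {n : ℕ} (a : ℕ) (t : Fin a → Fin n) (l : Fin n)
    (p : MvPolynomial (Fin n) F) : iterPDeriv a t (pderiv l p) = pderiv l (iterPDeriv a t p) := by
  induction a generalizing p with
  | zero => rw [aux_iter_zero, aux_iter_zero]
  | succ a ih => rw [aux_iter_succ, aux_iter_succ, aux_pderiv_comm, ih]

/-- Two multi-indices agree on all modes in `S`. -/
def AuxDep {m n' n a : ℕ} (S : Finset (Fin (a + 2))) (z z' : Fin m × Fin n' × (Fin a → Fin n)) :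
    Prop :=
  ((0 : Fin (a + 2)) ∈ S → z.1 = z'.1) ∧ ((1 : Fin (a + 2)) ∈ S → z.2.1 = z'.2.1) ∧
    ∀ s : Fin a, s.addNat 2 ∈ S → z.2.2 s = z'.2.2 s

/-- Denominator-cleared form of the conclusion. -/
def AuxP {F : Type} [Field F] {n : ℕ} (V : Set (Fin n → AlgebraicClosure F))
    (x₀ : Fin n → AlgebraicClosure F) {m n' : ℕ} (f : Fin m × Fin n' → MvPolynomial (Fin n) F)
    (N a : ℕ) : Prop :=
  ∃ (q : MvPolynomial (Fin n) F) (u v : Fin N → Finset (Fin (a + 2)) →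
      (Fin m × Fin n' × (Fin a → Fin n)) → MvPolynomial (Fin n) F),
    aeval x₀ q ≠ 0 ∧
    (∀ j S, ¬ (S.Nonempty ∧ Fin.last (a + 1) ∉ S) → ∀ z, u j S z = 0) ∧
    (∀ j S z z', AuxDep S z z' → u j S z = u j S z') ∧
    (∀ j S z z', AuxDep Sᶜ z z' → v j S z = v j S z') ∧
    ∀ z, ∀ x ∈ V, aeval x (q * iterPDeriv a z.2.2 (f (z.1, z.2.1)) -
      ∑ j, ∑ S, u j S z * v j S z) = 0

/-- Forget the last mode. -/
def auxR {m n' n a : ℕ} (z : Fin m × Fin n' × (Fin (a + 1) → Fin n)) :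
    Fin m × Fin n' × (Fin a → Fin n) := (z.1, z.2.1, fun s => z.2.2 s.castSucc)

/-- Preimage of a set of modes under the inclusion. -/
def auxPre {a : ℕ} (S : Finset (Fin (a + 3))) : Finset (Fin (a + 2)) :=
  Finset.univ.filter fun i => i.castSucc ∈ S

theorem auxPre_compl {a : ℕ} (S : Finset (Fin (a + 3))) : auxPre Sᶜ = (auxPre S)ᶜ := by
  ext i; simp [auxPre]

theorem auxPre_map {a : ℕ} (S : Finset (Fin (a + 2))) : auxPre (S.map Fin.castSuccEmb) = S := by
  ext i; simp [auxPre]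

theorem auxDep_pre {m n' n a : ℕ} (S : Finset (Fin (a + 3)))
    (z z' : Fin m × Fin n' × (Fin (a + 1) → Fin n)) (h : AuxDep S z z') :
    AuxDep (auxPre S) (auxR z) (auxR z') := by
  obtain ⟨h0, h1, h2⟩ := h
  refine ⟨fun h => h0 ?_, fun h => h1 ?_, fun s hs => h2 s.castSucc ?_⟩
  · simpa [auxPre] using h
  · have := (Finset.mem_filter.mp h).2
    exact this
  · have := (Finset.mem_filter.mp hs).2
    exact this

theorem auxDep_univ {m n' n a : ℕ} (z z' : Fin m × Fin n' × (Fin a → Fin n))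
    (h : AuxDep Finset.univ z z') : z = z' := by
  obtain ⟨h0, h1, h2⟩ := h
  refine Prod.ext (h0 (Finset.mem_univ _)) (Prod.ext (h1 (Finset.mem_univ _)) ?_)
  funext s
  exact h2 s (Finset.mem_univ _)

theorem auxDep_last {m n' n a : ℕ} (S : Finset (Fin (a + 3)))
    (z z' : Fin m × Fin n' × (Fin (a + 1) → Fin n)) (h : AuxDep S z z') (hS : Fin.last (a + 2) ∈ S) :
    z.2.2 (Fin.last a) = z'.2.2 (Fin.last a) := h.2.2 (Fin.last a) hS

theorem aux_sum_pad {R : Type} [AddCommMonoid R] {c N : ℕ} (h : c ≤ N) (G : Fin c → R) :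
    ∑ j : Fin N, (if hj : (j : ℕ) < c then G ⟨j, hj⟩ else 0) = ∑ k, G k := by
  symm
  refine Fintype.sum_of_injective (Fin.castLE h) (Fin.castLE_injective h) _ _ ?_ ?_
  · intro i hi
    rw [dif_neg]
    intro hlt
    exact hi ⟨⟨i, hlt⟩, rfl⟩
  · intro i
    simp

theorem aux_step {F : Type} [Field F] {n : ℕ} (V : Set (Fin n → AlgebraicClosure F))
    (x₀ : Fin n → AlgebraicClosure F) {m n' : ℕ} (f : Fin m × Fin n' → MvPolynomial (Fin n) F)
    (N : ℕ) (Δ : MvPolynomial (Fin n) F) (G : Fin N → MvPolynomial (Fin n) F)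
    (μ : Fin N → MvPolynomial (Fin n) F → MvPolynomial (Fin n) F) (hΔ : aeval x₀ Δ ≠ 0)
    (hkey : ∀ h : MvPolynomial (Fin n) F, (∀ x ∈ V, aeval x h = 0) →
        ∀ l, ∀ x ∈ V, aeval x (Δ * pderiv l h - ∑ k, μ k h * pderiv l (G k)) = 0)
    (a : ℕ) (hP : AuxP V x₀ f N a) : AuxP V x₀ f N (a + 1) := by
  classical
  obtain ⟨q, u, v, hq, hu0, hu, hv, hV⟩ := hP
  let h : (Fin m × Fin n' × (Fin a → Fin n)) → MvPolynomial (Fin n) F := fun z =>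
    q * iterPDeriv a z.2.2 (f (z.1, z.2.1)) - ∑ j, ∑ S, u j S z * v j S z
  refine ⟨Δ * q ^ 2,
    fun j S z => if Fin.last (a + 2) ∈ S then 0 else
      if auxPre S = Finset.univ then q * μ j (h (auxR z)) else
      if Fin.last (a + 1) ∉ auxPre S then u j (auxPre S) (auxR z)
      else v j (auxPre S)ᶜ (auxR z),
    fun j S z => if Fin.last (a + 2) ∈ S then 0 else
      if auxPre S = Finset.univ then pderiv (z.2.2 (Fin.last a)) (G j) else
      if Fin.last (a + 1) ∉ auxPre S then
        Δ * (q * pderiv (z.2.2 (Fin.last a)) (v j (auxPre S) (auxR z))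
          - pderiv (z.2.2 (Fin.last a)) q * v j (auxPre S) (auxR z))
      else Δ * q * pderiv (z.2.2 (Fin.last a)) (u j (auxPre S)ᶜ (auxR z)), ?_, ?_, ?_, ?_, ?_⟩
  · rw [map_mul, map_pow]
    exact mul_ne_zero hΔ (pow_ne_zero _ hq)
  · intro j S hS z
    dsimp only
    by_cases hl : Fin.last (a + 2) ∈ S
    · rw [if_pos hl]
    · have hSe : S = ∅ := by
        by_contra hne
        exact hS ⟨Finset.nonempty_iff_ne_empty.mpr hne, hl⟩
      have hpe : auxPre S = ∅ := by
        subst hSe; simp [auxPre]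
      rw [if_neg hl, if_neg, if_pos, hpe]
      · exact hu0 j ∅ (by simp) _
      · rw [hpe]; simp
      · rw [hpe]
        intro h
        have := Finset.mem_univ (0 : Fin (a + 2))
        rw [← h] at this
        simp at this
  · intro j S z z' hd
    have hd' := auxDep_pre S z z' hd
    dsimp only
    split_ifs with h1 h2 h3
    · rfl
    · rw [h2] at hd'
      rw [auxDep_univ _ _ hd']
    · exact hv j _ _ _ (by rwa [compl_compl])
    · exact hu j _ _ _ hd'
  · intro j S z z' hd
    have hd' := auxDep_pre _ z z' hd
    rw [auxPre_compl] at hd'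
    dsimp only
    by_cases h1 : Fin.last (a + 2) ∈ S
    · rw [if_pos h1, if_pos h1]
    · have hl := auxDep_last _ z z' hd (by simpa using h1)
      rw [hl, hv j _ _ _ hd', hu j _ _ _ hd']
  · intro z x hx
    set l := z.2.2 (Fin.last a) with hl
    set y := auxR z with hy
    have hcomm : iterPDeriv (a + 1) z.2.2 (f (z.1, z.2.1)) =
        pderiv l (iterPDeriv a y.2.2 (f (y.1, y.2.1))) := by
      rw [aux_iter_succ, aux_iter_comm]; rfl
    have hsum : ∀ j, ∑ S : Finset (Fin (a + 3)),
        ((if Fin.last (a + 2) ∈ S then 0 else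
          if auxPre S = Finset.univ then q * μ j (h y) else
          if Fin.last (a + 1) ∉ auxPre S then u j (auxPre S) y else v j (auxPre S)ᶜ y) *
        (if Fin.last (a + 2) ∈ S then 0 else
          if auxPre S = Finset.univ then pderiv l (G j) else
          if Fin.last (a + 1) ∉ auxPre S then
            Δ * (q * pderiv l (v j (auxPre S) y) - pderiv l q * v j (auxPre S) y)
          else Δ * q * pderiv l (u j (auxPre S)ᶜ y))) =
        q * (μ j (h y) * pderiv l (G j)) +
        (Δ * (q * ∑ S, u j S y * pderiv l (v j S y) - pderiv l q * ∑ S, u j S y * v j S y) +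
        Δ * q * ∑ S, v j S y * pderiv l (u j S y)) := by
      intro j
      have hstep : ∑ S : Finset (Fin (a + 2)),
          ((if S = Finset.univ then q * (μ j (h y) * pderiv l (G j)) else 0) +
            (u j S y * (Δ * (q * pderiv l (v j S y) - pderiv l q * v j S y)) +
             v j Sᶜ y * (Δ * q * pderiv l (u j Sᶜ y)))) =
          q * (μ j (h y) * pderiv l (G j)) +
          (Δ * (q * ∑ S, u j S y * pderiv l (v j S y) - pderiv l q * ∑ S, u j S y * v j S y) +
          Δ * q * ∑ S, v j S y * pderiv l (u j S y)) := by
        rw [Finset.sum_add_distrib, Finset.sum_add_distrib, Finset.sum_ite_eq',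
          if_pos (Finset.mem_univ _)]
        have hc : ∑ S : Finset (Fin (a + 2)), v j Sᶜ y * (Δ * q * pderiv l (u j Sᶜ y)) =
            ∑ S : Finset (Fin (a + 2)), v j S y * (Δ * q * pderiv l (u j S y)) :=
          Function.Bijective.sum_comp (compl_involutive.bijective)
            (fun S : Finset (Fin (a + 2)) => v j S y * (Δ * q * pderiv l (u j S y)))
        rw [hc]
        congr 2
        · rw [Finset.mul_sum, Finset.mul_sum, ← Finset.sum_sub_distrib, Finset.mul_sum]
          exact Finset.sum_congr rfl fun S _ => by ring
        · rw [Finset.mul_sum]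
          exact Finset.sum_congr rfl fun S _ => by ring
      rw [← hstep]
      symm
      refine Fintype.sum_of_injective (fun S : Finset (Fin (a + 2)) => S.map Fin.castSuccEmb)
        (Finset.map_injective _) _ _ ?_ ?_
      · intro S hS
        by_cases h1 : Fin.last (a + 2) ∈ S
        · rw [if_pos h1, zero_mul]
        · exfalso
          apply hS
          refine ⟨auxPre S, ?_⟩
          ext i
          simp only [Finset.mem_map, auxPre, Finset.mem_filter, Finset.mem_univ, true_and]
          constructor
          · rintro ⟨k, hk, rfl⟩; exact hk
          · intro hi
            have hne : i ≠ Fin.last (a + 2) := fun h => h1 (h ▸ hi)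
            exact ⟨i.castPred hne, by simpa using hi, by simp⟩
      · intro S
        have h1 : Fin.last (a + 2) ∉ S.map Fin.castSuccEmb := by
          simp [Fin.castSucc_ne_last]
        rw [if_neg h1, if_neg h1, auxPre_map]
        by_cases h2 : S = Finset.univ
        · subst h2
          rw [if_pos rfl, if_pos rfl, if_pos rfl, hu0 j Finset.univ (by simp),
            hu0 j (Finset.univᶜ) (by simp)]
          simp only [map_zero, mul_zero, zero_mul, add_zero]
          ring
        · rw [if_neg h2, if_neg h2, if_neg h2]
          by_cases h3 : Fin.last (a + 1) ∈ S
          · rw [if_neg (not_not.mpr h3), if_neg (not_not.mpr h3), hu0 j S (by simp [h3])]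
            ring
          · rw [if_pos h3, if_pos h3, hu0 j Sᶜ (by simp [h3])]
            simp
    rw [hcomm, Finset.sum_congr rfl (fun j _ => hsum j)]
    have e1 := hV y x hx
    have e2 := hkey (h y) (hV y) l x hx
    have hdh : pderiv l (h y) = pderiv l q * iterPDeriv a y.2.2 (f (y.1, y.2.1)) +
        q * pderiv l (iterPDeriv a y.2.2 (f (y.1, y.2.1))) -
        (∑ j, ∑ S, u j S y * pderiv l (v j S y) + ∑ j, ∑ S, v j S y * pderiv l (u j S y)) := by
      simp only [h, map_sub, map_sum, Derivation.leibniz, smul_eq_mul, Finset.sum_add_distrib]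
      ring
    rw [hdh] at e2
    have hid : Δ * q ^ 2 * pderiv l (iterPDeriv a y.2.2 (f (y.1, y.2.1))) -
        ∑ j, (q * (μ j (h y) * pderiv l (G j)) +
        (Δ * (q * ∑ S, u j S y * pderiv l (v j S y) - pderiv l q * ∑ S, u j S y * v j S y) +
        Δ * q * ∑ S, v j S y * pderiv l (u j S y))) =
        q * (Δ * (pderiv l q * iterPDeriv a y.2.2 (f (y.1, y.2.1)) +
        q * pderiv l (iterPDeriv a y.2.2 (f (y.1, y.2.1))) -
        (∑ j, ∑ S, u j S y * pderiv l (v j S y) + ∑ j, ∑ S, v j S y * pderiv l (u j S y))) -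
          ∑ k, μ k (h y) * pderiv l (G k)) -
        Δ * pderiv l q * (q * iterPDeriv a y.2.2 (f (y.1, y.2.1)) -
          ∑ j, ∑ S, u j S y * v j S y) := by
      simp_rw [Finset.sum_add_distrib, ← Finset.mul_sum, Finset.sum_sub_distrib, ← Finset.mul_sum]
      ring
    rw [hid, map_sub, map_mul, map_mul _ (Δ * _), e1, e2, mul_zero, mul_zero, sub_zero]

theorem aux_base {F : Type} [Field F] {n : ℕ} (V : Set (Fin n → AlgebraicClosure F))
    (x₀ : Fin n → AlgebraicClosure F) {m n' : ℕ} (f : Fin m × Fin n' → MvPolynomial (Fin n) F)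
    (r N : ℕ) (hrN : r ≤ N)
    (uN uD : Fin r → Fin m → MvPolynomial (Fin n) F)
    (vN vD : Fin r → Fin n' → MvPolynomial (Fin n) F)
    (hdom₀ : ∀ t, (∀ i, aeval x₀ (uD t i) ≠ 0) ∧ (∀ j, aeval x₀ (vD t j) ≠ 0))
    (hdecomp : ∀ x ∈ V,
      (∀ t, (∀ i, aeval x (uD t i) ≠ 0) ∧ (∀ j, aeval x (vD t j) ≠ 0)) →
      ∀ i j, aeval x (f (i, j)) =
        ∑ t : Fin r, (aeval x (uN t i) / aeval x (uD t i)) *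
          (aeval x (vN t j) / aeval x (vD t j))) : AuxP V x₀ f N 0 := by
  classical
  let qu : MvPolynomial (Fin n) F := ∏ t, ∏ i, uD t i
  let qv : MvPolynomial (Fin n) F := ∏ t, ∏ j, vD t j
  have hwU : ∀ t i, ∃ w, qu = uD t i * w := fun t i =>
    (Finset.dvd_prod_of_mem (uD t) (Finset.mem_univ i)).trans
      (Finset.dvd_prod_of_mem (fun t => ∏ i, uD t i) (Finset.mem_univ t))
  have hwV : ∀ t i, ∃ w, qv = vD t i * w := fun t i =>
    (Finset.dvd_prod_of_mem (vD t) (Finset.mem_univ i)).trans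
      (Finset.dvd_prod_of_mem (fun t => ∏ i, vD t i) (Finset.mem_univ t))
  choose wU hwU using hwU
  choose wV hwV using hwV
  refine ⟨(qu * qv) * (qu * qv),
    fun j S z => if S = {0} then
      (if h : (j : ℕ) < r then (qu * qv) * (uN ⟨j, h⟩ z.1 * wU ⟨j, h⟩ z.1) else 0) else 0,
    fun j S z => if S = {0} then
      (if h : (j : ℕ) < r then vN ⟨j, h⟩ z.2.1 * wV ⟨j, h⟩ z.2.1 else 0) else 0,
    ?_, ?_, ?_, ?_, ?_⟩
  · have h : aeval x₀ (qu * qv) ≠ 0 := by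
      simp only [qu, qv, map_mul, map_prod]
      refine mul_ne_zero ?_ ?_
      · exact Finset.prod_ne_zero_iff.mpr fun t _ => Finset.prod_ne_zero_iff.mpr fun i _ =>
          (hdom₀ t).1 i
      · exact Finset.prod_ne_zero_iff.mpr fun t _ => Finset.prod_ne_zero_iff.mpr fun i _ =>
          (hdom₀ t).2 i
    rw [map_mul]
    exact mul_ne_zero h h
  · intro j S hS z
    dsimp only
    rw [if_neg]
    rintro rfl
    exact hS ⟨⟨0, by simp⟩, by simp⟩
  · intro j S z z' hd
    dsimp only
    by_cases hS : S = {0}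
    · rw [hd.1 (by rw [hS]; simp)]
    · rw [if_neg hS, if_neg hS]
  · intro j S z z' hd
    dsimp only
    by_cases hS : S = {0}
    · rw [hd.2.1 (by rw [hS]; simp)]
    · rw [if_neg hS, if_neg hS]
  · intro z x hx
    have hsum : ∀ j : Fin N, ∑ S : Finset (Fin (0 + 2)),
        (if S = {0} then
          (if h : (j : ℕ) < r then (qu * qv) * (uN ⟨j, h⟩ z.1 * wU ⟨j, h⟩ z.1) else 0) else 0) *
        (if S = {0} then
          (if h : (j : ℕ) < r then vN ⟨j, h⟩ z.2.1 * wV ⟨j, h⟩ z.2.1 else 0) else 0) =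
        (if h : (j : ℕ) < r then (fun t : Fin r => (qu * qv) * ((uN t z.1 * wU t z.1) *
          (vN t z.2.1 * wV t z.2.1))) ⟨j, h⟩ else 0) := by
      intro j
      rw [Finset.sum_eq_single ({0} : Finset (Fin (0 + 2)))]
      · rw [if_pos rfl, if_pos rfl]
        split_ifs
        · ring
        · ring
      · intro S _ hS
        rw [if_neg hS, zero_mul]
      · intro h
        exact absurd (Finset.mem_univ _) h
    rw [Finset.sum_congr rfl (fun j _ => hsum j), aux_sum_pad hrN
        (fun t : Fin r => (qu * qv) * ((uN t z.1 * wU t z.1) * (vN t z.2.1 * wV t z.2.1))),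
      aux_iter_zero,
      ← Finset.mul_sum, mul_assoc, ← mul_sub, map_mul]
    by_cases h0 : aeval x (qu * qv) = 0
    · rw [h0, zero_mul]
    · have h0' := h0
      rw [map_mul] at h0'
      have hU := left_ne_zero_of_mul h0'
      have hW := right_ne_zero_of_mul h0'
      have hne : ∀ t, (∀ i, aeval x (uD t i) ≠ 0) ∧ (∀ j, aeval x (vD t j) ≠ 0) := by
        intro t
        constructor
        · intro i hi
          apply hU
          rw [hwU t i, map_mul, hi, zero_mul]
        · intro i hi
          apply hW
          rw [hwV t i, map_mul, hi, zero_mul]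
      rw [map_sub, map_mul _ (qu * qv), hdecomp x hx hne, map_sum, Finset.mul_sum,
        ← Finset.sum_sub_distrib, Finset.sum_eq_zero, mul_zero]
      intro t _
      have a1 := (hne t).1 z.1
      have a2 := (hne t).2 z.2.1
      have b1 : aeval x qu = aeval x (uD t z.1) * aeval x (wU t z.1) := by
        rw [hwU t z.1, map_mul]
      have b2 : aeval x qv = aeval x (vD t z.2.1) * aeval x (wV t z.2.1) := by
        rw [hwV t z.2.1, map_mul]
      simp only [map_mul]
      rw [b1, b2]
      field_simp
      ring

theorem aux_all (F : Type) [Field F] [PerfectField F] {n : ℕ}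
    (V : Set (Fin n → AlgebraicClosure F)) (hVirr : IsIrredVariety (AlgebraicClosure F) V)
    (hVF : IsZeroLocusOver F (AlgebraicClosure F) V)
    (x₀ : Fin n → AlgebraicClosure F) (hx₀ : IsNonsingularPoint (AlgebraicClosure F) V x₀)
    (c : ℕ) (hc : varDim (AlgebraicClosure F) V + (c : WithBot (WithTop ℕ))
      = (n : WithBot (WithTop ℕ))) {m n' : ℕ} (f : Fin m × Fin n' → MvPolynomial (Fin n) F)
    (N : ℕ) (hcN : c ≤ N) (h0 : AuxP V x₀ f N 0) (a : ℕ) : AuxP V x₀ f N a := by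
  obtain ⟨Δ, g, μ, hΔ, hk⟩ := aux_key F V hVirr hVF x₀ hx₀ c hc
  induction a with
  | zero => exact h0
  | succ a ih =>
    refine aux_step V x₀ f N Δ (fun j => if h : (j : ℕ) < c then g ⟨j, h⟩ else 0)
      (fun j p => if h : (j : ℕ) < c then μ ⟨j, h⟩ p else 0) hΔ ?_ a ih
    intro p hp l x hx
    have e : ∑ j : Fin N, (if h : (j : ℕ) < c then μ ⟨j, h⟩ p else 0) *
        pderiv l (if h : (j : ℕ) < c then g ⟨j, h⟩ else 0) = ∑ k, μ k p * pderiv l (g k) := by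
      rw [← aux_sum_pad hcN]
      refine Finset.sum_congr rfl fun j _ => ?_
      split_ifs
      · rfl
      · simp
    rw [e]
    exact hk p hp l x hx

theorem aux_cancel {F : Type} [Field F] {n : ℕ}
    (V : Set (Fin n → AlgebraicClosure F)) (hVirr : IsIrredVariety (AlgebraicClosure F) V)
    (x₀ : Fin n → AlgebraicClosure F) (hx₀ : x₀ ∈ V) (q p : MvPolynomial (Fin n) F)
    (hq : aeval x₀ q ≠ 0) (h : ∀ x ∈ V, aeval x (q * p) = 0) : ∀ x ∈ V, aeval x p = 0 := by
  have hae : ∀ (x : Fin n → AlgebraicClosure F) (r : MvPolynomial (Fin n) F),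
      aeval x r = eval x (map (algebraMap F (AlgebraicClosure F)) r) := by
    intro x r
    rw [eval_map]; rfl
  have hprime := aux_prime V hVirr
  have hm : map (algebraMap F (AlgebraicClosure F)) q * map (algebraMap F (AlgebraicClosure F)) p ∈
      _root_.vanishingIdeal (AlgebraicClosure F) V := by
    intro x hx
    rw [← map_mul, ← hae]
    exact h x hx
  rcases hprime.mem_or_mem hm with h1 | h1
  · exact absurd ((hae x₀ q).trans (h1 x₀ hx₀)) hq
  · intro x hx
    exact (hae x p).trans (h1 x hx)

end AuxHelpers

/-- **Corollary (iterated induction step)**: let `V ⊆ 𝔽̄^n` be an irreducible variety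
defined over a perfect field `𝔽`, `x₀` a non-singular point of `V`, and
`f : 𝔽^n → 𝔽^{m × n'}` a polynomial matrix. Suppose `f = IP ∘ H` on `V ∩ dom(H)` for a
rational map `H : 𝔽^n ⇢ C_r(A ⊗ B)` defined at `x₀`; for a matrix space the constructing
space has the single admissible subset `S = {1}`, so `H` amounts to a rational rank-`r`
factorization `f = ∑_{t<r} u_t ⊗ v_t`. Then for every `a : ℕ` the order-`a` total
derivative `D^a f` (an `(a+2)`-tensor-valued polynomial map, mode `0` of size `m`,
mode `1` of size `n'`, modes `2,…,a+1` of size `n`) satisfies `D^a f = IP ∘ H'` on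
`V ∩ dom(H')` for a rational map `H' : 𝔽^n ⇢ C_s(A ⊗ B ⊗ (𝔽^n)^{⊗a})` defined at `x₀`,
where `s = max r (codim V)`, the admissible subsets `S` being the nonempty subsets of
the first `a+1` of the `a+2` modes. `codim V = c` is encoded by `dim V + c = n`. -/
theorem statement4 (𝔽 : Type) [Field 𝔽] [PerfectField 𝔽]
    (n : ℕ) (V : Set (Fin n → AlgebraicClosure 𝔽))
    (hVirr : IsIrredVariety (AlgebraicClosure 𝔽) V)
    (hVF : IsZeroLocusOver 𝔽 (AlgebraicClosure 𝔽) V)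
    (x₀ : Fin n → AlgebraicClosure 𝔽)
    (hx₀ : IsNonsingularPoint (AlgebraicClosure 𝔽) V x₀)
    (m n' : ℕ) (f : Fin m × Fin n' → MvPolynomial (Fin n) 𝔽)
    (r : ℕ)
    (uN uD : Fin r → Fin m → MvPolynomial (Fin n) 𝔽)
    (vN vD : Fin r → Fin n' → MvPolynomial (Fin n) 𝔽)
    (hdom₀ : ∀ t, (∀ i, MvPolynomial.aeval x₀ (uD t i) ≠ 0) ∧
      (∀ j, MvPolynomial.aeval x₀ (vD t j) ≠ 0))
    (hdecomp : ∀ x ∈ V,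
      (∀ t, (∀ i, MvPolynomial.aeval x (uD t i) ≠ 0) ∧
        (∀ j, MvPolynomial.aeval x (vD t j) ≠ 0)) →
      ∀ i j, MvPolynomial.aeval x (f (i, j)) =
        ∑ t : Fin r,
          (MvPolynomial.aeval x (uN t i) / MvPolynomial.aeval x (uD t i)) *
          (MvPolynomial.aeval x (vN t j) / MvPolynomial.aeval x (vD t j)))
    (c : ℕ)
    (hc : varDim (AlgebraicClosure 𝔽) V + (c : WithBot (WithTop ℕ))
      = (n : WithBot (WithTop ℕ)))
    (a : ℕ) :
    ∃ uN' uD' vN' vD' : Fin (max r c) → Finset (Fin (a + 2)) →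
        ((Fin m × Fin n' × (Fin a → Fin n)) → MvPolynomial (Fin n) 𝔽),
      (∀ j S, ¬(S.Nonempty ∧ ∀ i : Fin (a + 2), i ∈ S → (i : ℕ) < a + 1) →
        ∀ z, uN' j S z = 0) ∧
      (∀ j S z z',
        ((0 : Fin (a + 2)) ∈ S → z.1 = z'.1) →
        ((1 : Fin (a + 2)) ∈ S → z.2.1 = z'.2.1) →
        (∀ s : Fin a, (⟨(s : ℕ) + 2, by omega⟩ : Fin (a + 2)) ∈ S → z.2.2 s = z'.2.2 s) →
        uN' j S z = uN' j S z' ∧ uD' j S z = uD' j S z') ∧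
      (∀ j S z z',
        ((0 : Fin (a + 2)) ∉ S → z.1 = z'.1) →
        ((1 : Fin (a + 2)) ∉ S → z.2.1 = z'.2.1) →
        (∀ s : Fin a, (⟨(s : ℕ) + 2, by omega⟩ : Fin (a + 2)) ∉ S → z.2.2 s = z'.2.2 s) →
        vN' j S z = vN' j S z' ∧ vD' j S z = vD' j S z') ∧
      (∀ j S z, MvPolynomial.aeval x₀ (uD' j S z) ≠ 0 ∧
        MvPolynomial.aeval x₀ (vD' j S z) ≠ 0) ∧
      (∀ x ∈ V,
        (∀ j S z, MvPolynomial.aeval x (uD' j S z) ≠ 0 ∧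
          MvPolynomial.aeval x (vD' j S z) ≠ 0) →
        ∀ (i : Fin m) (jj : Fin n') (t : Fin a → Fin n),
          MvPolynomial.aeval x (iterPDeriv a t (f (i, jj))) =
            ∑ j : Fin (max r c), ∑ S : Finset (Fin (a + 2)),
              (MvPolynomial.aeval x (uN' j S (i, jj, t)) /
                MvPolynomial.aeval x (uD' j S (i, jj, t))) *
              (MvPolynomial.aeval x (vN' j S (i, jj, t)) /
                MvPolynomial.aeval x (vD' j S (i, jj, t)))) := by
  obtain ⟨q, u, v, hq, hu0, hu, hv, hV⟩ := aux_all 𝔽 V hVirr hVF x₀ hx₀ c hc f (max r c)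
    (le_max_right _ _) (aux_base V x₀ f r (max r c) (le_max_left _ _) uN uD vN vD hdom₀ hdecomp) a
  refine ⟨u, fun _ _ _ => q, v, fun _ _ _ => 1, ?_, ?_, ?_, ?_, ?_⟩
  · intro j S hS
    refine hu0 j S fun h => hS ⟨h.1, fun i hi => ?_⟩
    have hne : i ≠ Fin.last (a + 1) := fun e => h.2 (e ▸ hi)
    have := Fin.val_ne_iff.mpr hne
    have h2 := i.isLt
    rw [Fin.val_last] at this
    omega
  · intro j S z z' h0 h1 h2
    exact ⟨hu j S z z' ⟨h0, h1, h2⟩, rfl⟩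
  · intro j S z z' h0 h1 h2
    exact ⟨hv j S z z' ⟨fun h => h0 (Finset.mem_compl.mp h), fun h => h1 (Finset.mem_compl.mp h),
      fun s h => h2 s (Finset.mem_compl.mp h)⟩, rfl⟩
  · intro j S z
    refine ⟨hq, ?_⟩
    dsimp only
    rw [map_one]
    exact one_ne_zero
  · intro x hx hne i jj t
    have e := hV (i, jj, t) x hx
    by_cases hN : Nonempty (Fin (max r c))
    · obtain ⟨j0⟩ := hN
      have hqx : MvPolynomial.aeval x q ≠ 0 := (hne j0 ∅ (i, jj, t)).1
      rw [map_sub, map_mul, sub_eq_zero] at e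
      apply mul_left_cancel₀ hqx
      rw [e, map_sum, Finset.mul_sum]
      refine Finset.sum_congr rfl fun j _ => ?_
      rw [map_sum, Finset.mul_sum]
      refine Finset.sum_congr rfl fun S _ => ?_
      dsimp only
      rw [map_mul, map_one, div_one]
      field_simp
    · have hE : IsEmpty (Fin (max r c)) := not_nonempty_iff.mp hN
      rw [Finset.univ_eq_empty, Finset.sum_empty]
      refine aux_cancel V hVirr x₀ hx₀.1 q _ hq (fun y hy => ?_) x hx
      have e2 := hV (i, jj, t) y hy
      rwa [Finset.univ_eq_empty, Finset.sum_empty, sub_zero] at e2
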